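/- Let A be the monomial algebra on 13 generators defined below and K the trivial A-module. Then there exist classes e₁, e₂ ∈ Extᴬ¹(K,K) and α, β, γ ∈ Extᴬ²(K,K) such that the Yoneda products e₁α ∈ Extᴬ³(K,K), βγ ∈ Extᴬ⁴(K,K), and γe₂ ∈ Extᴬ³(K,K) are all nonzero, while the Yoneda products (e₁α)β ∈ Extᴬ⁵(K,K) and (βγ)e₂ ∈ Extᴬ⁵(K,K) are both zero. -/

import Mathlib

/-!
Let `K` be a field and `V` a 13-dimensional `K`-vector space with basis
`{m,n,p,q,r,s,t,u,v,w,x,y,z}`.  Let `A = T(V)/I` be the quotient of the free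
(tensor) algebra on `V` by the two-sided ideal generated by the nine monomials
`mn²p, n²pqr, npqrs, pqrst, stu, tuvwx, uvwxy, vwxy², xy²z`, and regard `K` as
the trivial left `A`-module via the augmentation sending every generator to `0`.
-/

open CategoryTheory

/-- The thirteen generators `m,n,p,q,r,s,t,u,v,w,x,y,z` of the algebra `A`. -/
inductive Gen : Type
  | m | n | p | q | r | s | t | u | v | w | x | y | z

variable (K : Type) [Field K]

open Gen

/-- The generator `i`, as an element of the tensor algebra `T(V)`. -/
noncomputable def g (i : Gen) : FreeAlgebra K Gen := FreeAlgebra.ι K i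

/-- The relation identifying each of the nine defining monomials with `0`;
the quotient of `T(V)` by this relation is exactly `T(V)/I` where `I` is the
two-sided ideal generated by the nine monomials. -/
inductive MonRel : FreeAlgebra K Gen → FreeAlgebra K Gen → Prop
  | mnnp : MonRel (g K m * g K n * g K n * g K p) 0
  | nnpqr : MonRel (g K n * g K n * g K p * g K q * g K r) 0
  | npqrs : MonRel (g K n * g K p * g K q * g K r * g K s) 0
  | pqrst : MonRel (g K p * g K q * g K r * g K s * g K t) 0
  | stu : MonRel (g K s * g K t * g K u) 0
  | tuvwx : MonRel (g K t * g K u * g K v * g K w * g K x) 0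
  | uvwxy : MonRel (g K u * g K v * g K w * g K x * g K y) 0
  | vwxyy : MonRel (g K v * g K w * g K x * g K y * g K y) 0
  | xyyz : MonRel (g K x * g K y * g K y * g K z) 0

/-- The monomial algebra `A = T(V)/I`. -/
noncomputable abbrev A : Type := RingQuot (MonRel K)

/-- The augmentation `A →ₐ[K] K`, sending every generator to `0`. -/
noncomputable def aug : A K →ₐ[K] K :=
  RingQuot.liftAlgHom K ⟨FreeAlgebra.lift K (fun _ => (0 : K)), by
    rintro x y h
    induction h <;> simp [g]⟩

/-- `K`, regarded as the trivial left `A`-module via the augmentation. -/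
noncomputable def KMod : ModuleCat.{0} (A K) :=
  letI : Module (A K) K := Module.compHom K (aug K).toRingHom
  ModuleCat.of (A K) K

noncomputable local instance instDC : HasDerivedCategory.{1} (ModuleCat.{0} (A K)) :=
  HasDerivedCategory.standard _

local instance instHE : HasExt.{1} (ModuleCat.{0} (A K)) :=
  @hasExt_of_hasDerivedCategory.{1, 0, 1} (ModuleCat.{0} (A K)) _ _ (instDC K)

/-- The Ext group `Extᴬⁿ(K, K)`; the Yoneda product of `a : E K i` and
`b : E K j` is given by the composition `a.comp b : E K (i + j)`. -/
noncomputable abbrev E (n : ℕ) : Type 1 := Abelian.Ext (KMod K) (KMod K) n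



namespace MonomialAlgebra

instance : DecidableEq Gen := fun a b => by
  cases a <;> cases b <;> first | exact isTrue rfl | exact isFalse nofun

/-- The nine defining monomials, as words in the generators. -/
def relations : List (List Gen) :=
  [[m, n, n, p], [n, n, p, q, r], [n, p, q, r, s], [p, q, r, s, t], [s, t, u],
    [t, u, v, w, x], [u, v, w, x, y], [v, w, x, y, y], [x, y, y, z]]

/-- The class of a generator in `A`. -/
noncomputable def gen (i : Gen) : A K := RingQuot.mkAlgHom K (MonRel K) (g K i)

/-- The class in `A` of a word in the generators. -/
noncomputable def word (L : List Gen) : A K := (L.map (gen K)).prod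

/-- A word in the generators, as an element of the free algebra. -/
noncomputable def freeWord (L : List Gen) : FreeAlgebra K Gen := (L.map (g K)).prod

@[simp] lemma word_nil : word K [] = 1 := rfl

@[simp] lemma word_singleton (l : Gen) : word K [l] = gen K l := by simp [word]

lemma word_append (L L' : List Gen) : word K (L ++ L') = word K L * word K L' := by
  simp [word]

lemma mkAlgHom_freeWord (L : List Gen) :
    RingQuot.mkAlgHom K (MonRel K) (freeWord K L) = word K L := by
  simp [word, freeWord, map_list_prod, Function.comp_def]; rfl

lemma exists_relation_of_monRel {a b : FreeAlgebra K Gen} (h : MonRel K a b) :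
    ∃ L ∈ relations, a = freeWord K L ∧ b = 0 := by
  cases h
  · exact ⟨[m, n, n, p], by decide, by simp [freeWord, mul_assoc], rfl⟩
  · exact ⟨[n, n, p, q, r], by decide, by simp [freeWord, mul_assoc], rfl⟩
  · exact ⟨[n, p, q, r, s], by decide, by simp [freeWord, mul_assoc], rfl⟩
  · exact ⟨[p, q, r, s, t], by decide, by simp [freeWord, mul_assoc], rfl⟩
  · exact ⟨[s, t, u], by decide, by simp [freeWord, mul_assoc], rfl⟩
  · exact ⟨[t, u, v, w, x], by decide, by simp [freeWord, mul_assoc], rfl⟩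
  · exact ⟨[u, v, w, x, y], by decide, by simp [freeWord, mul_assoc], rfl⟩
  · exact ⟨[v, w, x, y, y], by decide, by simp [freeWord, mul_assoc], rfl⟩
  · exact ⟨[x, y, y, z], by decide, by simp [freeWord, mul_assoc], rfl⟩

lemma monRel_of_mem_relations {L : List Gen} (h : L ∈ relations) : MonRel K (freeWord K L) 0 := by
  simp only [relations, List.mem_cons, List.not_mem_nil, or_false] at h
  rcases h with rfl | rfl | rfl | rfl | rfl | rfl | rfl | rfl | rfl
  · simpa [freeWord, mul_assoc] using MonRel.mnnp (K := K)
  · simpa [freeWord, mul_assoc] using MonRel.nnpqr (K := K)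
  · simpa [freeWord, mul_assoc] using MonRel.npqrs (K := K)
  · simpa [freeWord, mul_assoc] using MonRel.pqrst (K := K)
  · simpa [freeWord, mul_assoc] using MonRel.stu (K := K)
  · simpa [freeWord, mul_assoc] using MonRel.tuvwx (K := K)
  · simpa [freeWord, mul_assoc] using MonRel.uvwxy (K := K)
  · simpa [freeWord, mul_assoc] using MonRel.vwxyy (K := K)
  · simpa [freeWord, mul_assoc] using MonRel.xyyz (K := K)

lemma word_eq_zero {L : List Gen} (h : ∃ L' ∈ relations, L' <:+: L) : word K L = 0 := by
  obtain ⟨L', h, a, b, rfl⟩ := h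
  have := RingQuot.mkAlgHom_rel K (monRel_of_mem_relations K h)
  rw [mkAlgHom_freeWord, map_zero] at this
  simp [word_append, this]

@[simp] lemma aug_gen (i : Gen) : aug K (gen K i) = 0 := by
  simp [aug, gen, g]

/-- A `K`-linear map commuting with the generators is `A`-linear. -/
def linearMapOfGen {M N : Type} [AddCommGroup M] [Module K M] [Module (A K) M]
    [IsScalarTower K (A K) M] [AddCommGroup N] [Module K N] [Module (A K) N]
    [IsScalarTower K (A K) N] (f : M →ₗ[K] N)
    (hf : ∀ i x, f (gen K i • x) = gen K i • f x) : M →ₗ[A K] N where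
  toFun := f
  map_add' := f.map_add
  map_smul' a x := by
    obtain ⟨a, rfl⟩ := RingQuot.mkAlgHom_surjective K (MonRel K) a
    induction a using FreeAlgebra.induction generalizing x with
    | grade0 c => simp
    | grade1 i => exact hf i x
    | mul a b ha hb => simp only [map_mul, mul_smul, RingHom.id_apply] at *; rw [ha, hb]
    | add a b ha hb => simp only [map_add, add_smul, RingHom.id_apply] at *; rw [ha, hb]

instance : Module K (KMod K) := inferInstanceAs (Module K K)

/-- The identification of the underlying vector space of the trivial module with `K`. -/
noncomputable def kModEquiv : K ≃ₗ[K] KMod K := LinearEquiv.refl K K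

/-- The generator of the trivial module. -/
noncomputable def unit : KMod K := kModEquiv K 1

lemma smul_kMod (a : A K) (x : KMod K) : a • x = aug K a • x := rfl

instance : IsScalarTower K (A K) (KMod K) where
  smul_assoc k a x := by simp [smul_kMod, mul_smul]

variable {K}

variable (K) in
/-- The elements of a module annihilated by a list of words. -/
def Kills (S : List (List Gen)) {M : Type} [AddCommGroup M] [Module (A K) M] (c : M) : Prop :=
  ∀ L ∈ S, word K L • c = 0

lemma _root_.List.IsSuffix.append_right {α : Type*} {L L' : List α} (h : L <:+ L') (a : List α) :
    L ++ a <:+ L' ++ a := by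
  obtain ⟨b, rfl⟩ := h
  exact ⟨b, by simp⟩

/-- A combinatorial condition on a word `b` and a list of words `S` ensuring that any element
killed by `S` of an `A`-module `M` is of the form `b • t` for some `t` in an extension of `M`. -/
def Compat (b : List Gen) (S : List (List Gen)) : Prop :=
  ∀ L ∈ relations, ∀ a ∈ b.inits, a ≠ [] →
    ¬ L <:+ a ∧ (a <:+ L → ∃ L' ∈ S, L' <:+ L.take (L.length - a.length))

instance (b : List Gen) (S : List (List Gen)) : Decidable (Compat b S) := by
  unfold Compat; infer_instance

section OneExt

variable {M : Type} [AddCommGroup M] [Module K M] [Module (A K) M] [IsScalarTower K (A K) M]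

variable (K) in
/-- The element `c` is killed by every word `L` such that `L l` is a relation. -/
def Extendable (c : M) (l : Gen) : Prop :=
  ∀ L, L ++ [l] ∈ relations → word K L • c = 0

/-- The action of a generator on the extension of `K` by `M` in which `l` sends `1 : K` to `c`. -/
noncomputable def genAct (c : M) (l i : Gen) : Module.End K (M × K) :=
  LinearMap.prod
    (Algebra.lsmul K K M (gen K i) ∘ₗ LinearMap.fst K M K +
      (if i = l then LinearMap.toSpanSingleton K M c else 0) ∘ₗ LinearMap.snd K M K) 0

lemma genAct_apply (c : M) (l i : Gen) (y : M × K) :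
    genAct c l i y = (gen K i • y.1 + if i = l then y.2 • c else 0, 0) := by
  simp only [genAct]
  split_ifs <;> simp

lemma lift_genAct_apply (c : M) (l : Gen) (f : FreeAlgebra K Gen) (y : M) :
    FreeAlgebra.lift K (genAct c l) f (y, (0 : K)) =
      (RingQuot.mkAlgHom K (MonRel K) f • y, (0 : K)) := by
  induction f using FreeAlgebra.induction generalizing y with
  | grade0 k => simp [Algebra.algebraMap_eq_smul_one]
  | grade1 i => simp [genAct_apply, gen, g]
  | mul a b ha hb => simp [ha, hb, mul_smul]
  | add a b ha hb => simp [ha, hb, add_smul]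

/-- The action of `A` on the extension of `K` by `M` in which `l` sends `1 : K` to `c`. -/
noncomputable def extAct {c : M} {l : Gen} (h : Extendable K c l) :
    A K →ₐ[K] Module.End K (M × K) :=
  RingQuot.liftAlgHom K ⟨FreeAlgebra.lift K (genAct c l), by
    intro a b hab
    obtain ⟨L, hL, rfl, rfl⟩ := exists_relation_of_monRel K hab
    rw [map_zero]
    obtain rfl | ⟨L, i, rfl⟩ := L.eq_nil_or_concat'
    · exact absurd hL (by decide)
    ext1
    all_goals
      refine LinearMap.ext fun y => ?_
      have h0 := word_eq_zero K ⟨_, hL, List.infix_rfl⟩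
      rw [word_append, word_singleton] at h0
      have h1 : freeWord K (L ++ [i]) = freeWord K L * g K i := by simp [freeWord]
      simp only [h1, map_mul, g, FreeAlgebra.lift_ι_apply, LinearMap.comp_apply,
        Module.End.mul_apply, genAct_apply, lift_genAct_apply, mkAlgHom_freeWord]
      rw [smul_add, smul_smul, h0]
      split_ifs with hi
      · subst hi
        rw [smul_comm, h L hL]
        simp
      · simp⟩

/-- The extension of `K` by `M` in which `l` sends `1 : K` to `c` and the other generators act
on it by zero. -/
def OneExt {c : M} {l : Gen} (_ : Extendable K c l) : Type := M × K

namespace OneExt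

variable {c : M} {l : Gen} (h : Extendable K c l)

instance : AddCommGroup (OneExt h) := inferInstanceAs (AddCommGroup (M × K))

instance : Module K (OneExt h) := inferInstanceAs (Module K (M × K))

noncomputable instance : Module (A K) (OneExt h) :=
  Module.compHom (M × K) (extAct h).toRingHom

lemma smul_def (a : A K) (y : OneExt h) : a • y = extAct h a y := rfl

instance : IsScalarTower K (A K) (OneExt h) where
  smul_assoc k a y := by
    rw [smul_def, smul_def, map_smul]; rfl

/-- The identification of the underlying vector space with `M × K`. -/
def of : (M × K) ≃ₗ[K] OneExt h := LinearEquiv.refl K (M × K)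

lemma gen_smul (i : Gen) (y : M × K) :
    gen K i • of h y = of h (gen K i • y.1 + if i = l then y.2 • c else 0, 0) := by
  rw [← genAct_apply, smul_def]
  simp [extAct, gen, g]
  rfl

/-- The inclusion of `M`. -/
noncomputable def inl : M →ₗ[A K] OneExt h :=
  linearMapOfGen K ((of h).toLinearMap ∘ₗ LinearMap.inl K M K) fun i y => by
    simp [gen_smul]

/-- The projection to `K`. -/
noncomputable def snd : OneExt h →ₗ[A K] KMod K :=
  linearMapOfGen K
    ((kModEquiv K).toLinearMap ∘ₗ LinearMap.snd K M K ∘ₗ (of h).symm.toLinearMap) fun i y => by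
    obtain ⟨y, rfl⟩ := (of h).surjective y
    simp [smul_kMod, gen_smul]

/-- The lift of `1 : K`. -/
def top : OneExt h := of h (0, 1)

lemma gen_smul_top (i : Gen) : gen K i • top h = if i = l then inl h c else 0 := by
  rw [top, gen_smul]
  split_ifs with hi
  · simp; rfl
  · simp

lemma snd_top : snd h (top h) = unit K := rfl

lemma inl_injective : Function.Injective (inl h) := fun _ _ e => congrArg Prod.fst e

lemma snd_surjective : Function.Surjective (snd h) := fun k => ⟨((0, k) : M × K), rfl⟩

lemma exact : Function.Exact (inl h) (snd h) := fun y =>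
  ⟨fun e => ⟨y.1, Prod.ext rfl (Eq.symm e)⟩, by rintro ⟨y, rfl⟩; rfl⟩

end OneExt

omit [Module K M] [IsScalarTower K (A K) M] in
lemma smul_eq_zero_of_suffix {c : M} {L L' : List Gen} (h : L' <:+ L) (hc : word K L' • c = 0) :
    word K L • c = 0 := by
  obtain ⟨L, rfl⟩ := h
  rw [word_append, mul_smul, hc, smul_zero]

omit [Module K M] [IsScalarTower K (A K) M] in
lemma Compat.smul_eq_zero {b : List Gen} {S : List (List Gen)} (hb : Compat b S) {c : M}
    (hc : Kills K S c) {L a : List Gen} (hL : L ++ a ∈ relations) (ha : a <+: b) (ha' : a ≠ []) :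
    word K L • c = 0 := by
  obtain ⟨L', h1, h2⟩ := (hb _ hL a (by simpa using ha) ha').2 (List.suffix_append _ _)
  exact smul_eq_zero_of_suffix (by simpa using h2) (hc _ h1)

omit [Module K M] [IsScalarTower K (A K) M] in
lemma Compat.extendable {l : Gen} {S : List (List Gen)} (hb : Compat [l] S) {c : M}
    (hc : Kills K S c) : Extendable K c l :=
  fun _ hL => hb.smul_eq_zero hc hL List.prefix_rfl (by simp)

/-- An element killed by `S` becomes a multiple of `b` in some extension of the module. -/
theorem Compat.exists_extension {b : List Gen} {S : List (List Gen)} (hb : Compat b S) {c : M}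
    (hc : Kills K S c) :
    ∃ (T : Type) (_ : AddCommGroup T) (_ : Module K T) (_ : Module (A K) T)
      (_ : IsScalarTower K (A K) T) (t : T) (j : M →ₗ[A K] T), Function.Injective j ∧
      word K b • t = j c ∧ ∀ L, ¬ L <:+ b → ¬ b <:+ L → word K L • t = 0 := by
  induction b using List.reverseRecOn with
  | nil =>
    exact ⟨M, _, _, _, ‹_›, c, .id, fun _ _ h => h, by simp, fun L _ h => absurd L.nil_suffix h⟩
  | append_singleton b l ih =>
    obtain ⟨T, _, _, _, _, t, j, hj, hbt, ht⟩ := ih fun L hL a ha =>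
      hb L hL a (by simp only [List.mem_inits] at *; exact ha.trans (List.prefix_append _ _))
    have h : Extendable K t l := by
      intro L hL
      by_cases h1 : L <:+ b
      · exact absurd (h1.append_right [l]) (hb _ hL (b ++ [l]) (by simp) (by simp)).1
      by_cases h2 : b <:+ L
      · obtain ⟨L, rfl⟩ := h2
        rw [word_append, mul_smul, hbt, ← map_smul,
          hb.smul_eq_zero hc (by simpa using hL) List.prefix_rfl (by simp), map_zero]
      · exact ht L h1 h2
    refine ⟨OneExt h, _, _, _, inferInstance, OneExt.top h, OneExt.inl h ∘ₗ j,
      (OneExt.inl_injective h).comp hj, ?_, fun L h1 h2 => ?_⟩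
    · simp [word_append, mul_smul, OneExt.gen_smul_top, ← map_smul, hbt]
    · obtain rfl | ⟨L, i, rfl⟩ := L.eq_nil_or_concat'
      · exact absurd (List.nil_suffix) h1
      rw [word_append, mul_smul, word_singleton, OneExt.gen_smul_top]
      split_ifs with hi
      · subst hi
        rw [← map_smul, ht L (fun h => h1 (h.append_right _)) (fun h => h2 (h.append_right _)),
          map_zero]
      · rw [smul_zero]

end OneExt

variable (K) in
/-- The cyclic left module `A / (A L₁ + ⋯ + A Lₖ)` for a list of words `L₁, …, Lₖ`. -/
abbrev Cyc (S : List (List Gen)) : Type := A K ⧸ Submodule.span (A K) (word K '' {L | L ∈ S})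

namespace Cyc

variable (K) in
/-- The generator of the cyclic module. -/
def one (S : List (List Gen)) : Cyc K S := Submodule.Quotient.mk 1

lemma smul_one (S : List (List Gen)) (a : A K) : a • one K S = Submodule.Quotient.mk a := by
  rw [one, ← Submodule.Quotient.mk_smul, smul_eq_mul, mul_one]

lemma kills_one (S : List (List Gen)) : Kills K S (one K S) := fun L hL => by
  rw [smul_one, Submodule.Quotient.mk_eq_zero]
  exact Submodule.subset_span ⟨L, hL, rfl⟩

variable {M : Type} [AddCommGroup M] [Module (A K) M]

/-- The map out of a cyclic module given by the image of the generator. -/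
noncomputable def desc {S : List (List Gen)} {c : M} (hc : Kills K S c) : Cyc K S →ₗ[A K] M :=
  Submodule.liftQ _ (LinearMap.toSpanSingleton (A K) M c) (by
    rw [Submodule.span_le]
    rintro _ ⟨L, hL, rfl⟩
    simpa using hc L hL)

@[simp] lemma desc_one {S : List (List Gen)} {c : M} (hc : Kills K S c) : desc hc (one K S) = c := by
  simp [desc, one]

lemma hom_ext {S : List (List Gen)} {f f' : Cyc K S →ₗ[A K] M}
    (h : f (one K S) = f' (one K S)) : f = f' :=
  Submodule.linearMap_qext _ (LinearMap.ext_ring h)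

lemma exists_smul_one {S : List (List Gen)} (y : Cyc K S) : ∃ a : A K, y = a • one K S := by
  obtain ⟨a, rfl⟩ := Submodule.Quotient.mk_surjective _ y
  exact ⟨a, (smul_one _ _).symm⟩

instance : Module.Projective (A K) (Cyc K []) :=
  Module.Projective.of_equiv (Submodule.quotEquivOfEqBot _ (by simp)).symm

lemma desc_word_injective {b : List Gen} {S : List (List Gen)} (hb : Compat b S)
    (hS : Kills K S (word K b)) : Function.Injective (desc hS) := by
  obtain ⟨T, _, _, _, _, t, j, hj, hbt, -⟩ := hb.exists_extension (kills_one (K := K) S)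
  have : LinearMap.toSpanSingleton (A K) T t ∘ₗ desc hS = j := hom_ext (by simpa using hbt)
  rw [← this, LinearMap.coe_comp] at hj
  exact hj.of_comp

end Cyc


section Ext

open Abelian

variable {X Y Z : ModuleCat.{0} (A K)}

/-- The short complex given by an exact pair of linear maps. -/
abbrev exactComplex (f : X →ₗ[A K] Y) (g : Y →ₗ[A K] Z) (h : Function.Exact f g) :
    ShortComplex (ModuleCat.{0} (A K)) where
  X₁ := X
  X₂ := Y
  X₃ := Z
  f := ModuleCat.ofHom f
  g := ModuleCat.ofHom g
  zero := by ext a; exact h.apply_apply_eq_zero a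

lemma exactComplex_shortExact {f : X →ₗ[A K] Y} {g : Y →ₗ[A K] Z} (h : Function.Exact f g)
    (hf : Function.Injective f) (hg : Function.Surjective g) :
    (exactComplex f g h).ShortExact :=
  ModuleCat.shortComplex_shortExact _ h hf hg

lemma extClass_comp_mk₀ {S S' : ShortComplex (ModuleCat.{0} (A K))} (hS : S.ShortExact)
    (hS' : S'.ShortExact) (a : S.X₁ ⟶ S'.X₁) (b : S.X₂ ⟶ S'.X₂) (c : S.X₃ ⟶ S'.X₃)
    (h₁ : b.hom ∘ₗ S.f.hom = S'.f.hom ∘ₗ a.hom) (h₂ : c.hom ∘ₗ S.g.hom = S'.g.hom ∘ₗ b.hom) :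
    hS.extClass.comp (Ext.mk₀ a) (add_zero 1) = (Ext.mk₀ c).comp hS'.extClass (zero_add 1) :=
  ShortComplex.ShortExact.extClass_naturality hS hS'
    { τ₁ := a
      τ₂ := b
      τ₃ := c
      comm₁₂ := ModuleCat.hom_ext h₁.symm
      comm₂₃ := ModuleCat.hom_ext h₂.symm }

lemma eq_zero_of_extClass_comp_eq_zero {S : ShortComplex (ModuleCat.{0} (A K))}
    (hS : S.ShortExact) [Projective S.X₂] {i j : ℕ} (y : Ext S.X₁ X (i + 1))
    (hj : 1 + (i + 1) = j) (hy : hS.extClass.comp y hj = 0) : y = 0 := by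
  obtain ⟨y', rfl⟩ := Ext.contravariant_sequence_exact₁ hS _ y hj hy
  rw [Ext.eq_zero_of_projective y', Ext.comp_zero]

variable (K) in
/-- The cyclic module associated with a list of words, as an object of the module category. -/
noncomputable abbrev cyc (S : List (List Gen)) : ModuleCat.{0} (A K) := ModuleCat.of (A K) (Cyc K S)

lemma kills_unit {S : List (List Gen)} (hS : [] ∉ S) : Kills K S (unit K) := fun L hL => by
  obtain rfl | ⟨L, i, rfl⟩ := L.eq_nil_or_concat'
  · exact absurd hL hS
  · simp [word_append, mul_smul, smul_kMod]

variable (K) in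
/-- The projection of a cyclic module to the trivial module. -/
noncomputable def proj (S : List (List Gen)) (hS : [] ∉ S) : cyc K S ⟶ KMod K :=
  ModuleCat.ofHom (X := Cyc K S) (Y := KMod K) (Cyc.desc (kills_unit hS))

@[simp] lemma proj_one (S : List (List Gen)) (hS : [] ∉ S) :
    (proj K S hS).hom (Cyc.one K S) = unit K :=
  Cyc.desc_one (kills_unit hS)

section Letter

variable {S : List (List Gen)} {l : Gen} (h : Compat [l] S)

variable (K S l) in
/-- The underlying module of the extension `letterComplex`. -/
abbrev LetterExt : Type := OneExt (h.extendable (Cyc.kills_one (K := K) S))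

variable (K) in
/-- The short complex `Cyc S → LetterExt → K`. -/
noncomputable abbrev letterComplex : ShortComplex (ModuleCat.{0} (A K)) :=
  exactComplex (X := cyc K S) (Y := ModuleCat.of (A K) (LetterExt K S l h)) (Z := KMod K)
    (OneExt.inl (h.extendable (Cyc.kills_one S))) (OneExt.snd (h.extendable (Cyc.kills_one S)))
    (OneExt.exact (h.extendable (Cyc.kills_one S)))

variable (K) in
lemma letterComplex_shortExact : (letterComplex K h).ShortExact :=
  exactComplex_shortExact (X := cyc K S) (Y := ModuleCat.of (A K) (LetterExt K S l h))
    (Z := KMod K) (OneExt.exact (h.extendable (Cyc.kills_one S)))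
    (OneExt.inl_injective (h.extendable (Cyc.kills_one S)))
    (OneExt.snd_surjective (h.extendable (Cyc.kills_one S)))

variable (K) in
/-- The class of the extension of the trivial module by a cyclic module in which the letter `l`
sends a lift of the generator of the former to the generator of the latter. -/
noncomputable def letterClass : Ext.{1} (KMod K) (cyc K S) 1 :=
  (letterComplex_shortExact K h).extClass

end Letter

section Step

variable {S : List (List Gen)} {b : List Gen}

lemma exact_desc_mkQ (hS : Kills K S (word K b)) :
    Function.Exact (Cyc.desc hS)
      (Submodule.mkQ (Submodule.span (A K) (word K '' {L | L ∈ [b]}))) := by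
  intro a
  simp only [Submodule.mkQ_apply, Submodule.Quotient.mk_eq_zero, List.mem_singleton,
    Set.ofPred_eq_eq_singleton, Set.image_singleton, Submodule.mem_span_singleton]
  constructor
  · rintro ⟨a, rfl⟩
    exact ⟨a • Cyc.one K S, by simp⟩
  · rintro ⟨y, rfl⟩
    obtain ⟨a, rfl⟩ := Cyc.exists_smul_one y
    exact ⟨a, by simp⟩

/-- The short complex `Cyc S → A → A / A b`. -/
noncomputable abbrev stepComplex (hS : Kills K S (word K b)) : ShortComplex (ModuleCat.{0} (A K)) :=
  exactComplex (X := cyc K S) (Y := ModuleCat.of (A K) (A K)) (Z := cyc K [b])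
    (Cyc.desc hS) (Submodule.mkQ _) (exact_desc_mkQ hS)

lemma stepComplex_shortExact (h : Compat b S) (hS : Kills K S (word K b)) :
    (stepComplex hS).ShortExact :=
  exactComplex_shortExact _ (Cyc.desc_word_injective h hS) (Submodule.mkQ_surjective _)

/-- The class of the extension `0 → Cyc S → A → A / A b → 0`. -/
noncomputable def stepClass (h : Compat b S) (hS : Kills K S (word K b)) :
    Ext.{1} (cyc K [b]) (cyc K S) 1 :=
  (stepComplex_shortExact h hS).extClass

end Step

lemma stepClass_comp_desc_eq_proj_comp_letterClass {S S' : List (List Gen)} {b : List Gen} {l : Gen}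
    (h : Compat (b ++ [l]) S) (hS : Kills K S (word K (b ++ [l]))) (h' : Compat [l] S')
    (hb : Kills K S (word K b • Cyc.one K S')) :
    (stepClass h hS).comp (Ext.mk₀ (ModuleCat.ofHom (Cyc.desc hb))) (add_zero 1) =
      (Ext.mk₀ (proj K [b ++ [l]] (by simp))).comp (letterClass K h') (zero_add 1) := by
  refine extClass_comp_mk₀ (stepComplex_shortExact h hS) (letterComplex_shortExact K h')
    (ModuleCat.ofHom (Cyc.desc hb))
    (ModuleCat.ofHom (LinearMap.toSpanSingleton (A K) _
      (OneExt.top (h'.extendable (Cyc.kills_one (K := K) S')))))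
    (proj K [b ++ [l]] (by simp)) (Cyc.hom_ext ?_) (LinearMap.ext_ring ?_)
  · change Cyc.desc hS (Cyc.one K S) • OneExt.top (h'.extendable (Cyc.kills_one (K := K) S')) =
      OneExt.inl (h'.extendable (Cyc.kills_one (K := K) S')) (Cyc.desc hb (Cyc.one K S))
    rw [Cyc.desc_one, Cyc.desc_one, word_append, mul_smul, word_singleton, OneExt.gen_smul_top,
      if_pos rfl, map_smul]
  · refine (proj_one [b ++ [l]] (by simp)).trans ?_
    change _ = OneExt.snd (h'.extendable (Cyc.kills_one (K := K) S'))
      ((1 : A K) • OneExt.top (h'.extendable (Cyc.kills_one (K := K) S')))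
    rw [one_smul, OneExt.snd_top]

lemma stepClass_comp_desc_eq_desc_comp_stepClass {S : List (List Gen)} {a b : List Gen}
    (h : Compat a []) (hS : Kills K [] (word K a)) (h' : Compat (a ++ b) S)
    (hS' : Kills K S (word K (a ++ b))) (h₁ : Kills K [] (Cyc.one K S))
    (hb : Kills K [a] (word K b • Cyc.one K [a ++ b])) :
    (stepClass h hS).comp (Ext.mk₀ (ModuleCat.ofHom (Cyc.desc h₁))) (add_zero 1) =
      (Ext.mk₀ (ModuleCat.ofHom (Cyc.desc hb))).comp (stepClass h' hS') (zero_add 1) := by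
  refine extClass_comp_mk₀ (stepComplex_shortExact h hS) (stepComplex_shortExact h' hS')
    (ModuleCat.ofHom (Cyc.desc h₁))
    (ModuleCat.ofHom (LinearMap.toSpanSingleton (A K) (A K) (word K b)))
    (ModuleCat.ofHom (Cyc.desc hb)) (Cyc.hom_ext ?_) (LinearMap.ext_ring ?_)
  · change Cyc.desc hS (Cyc.one K []) • word K b = Cyc.desc hS' (Cyc.desc h₁ (Cyc.one K []))
    rw [Cyc.desc_one, Cyc.desc_one, Cyc.desc_one, word_append, smul_eq_mul]
  · change Cyc.desc hb (Cyc.one K [a]) = Submodule.Quotient.mk ((1 : A K) • word K b)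
    rw [Cyc.desc_one, one_smul, Cyc.smul_one]

instance (M : Type) [AddCommGroup M] [Module (A K) M] [Module.Projective (A K) M] :
    Projective (ModuleCat.of (A K) M) :=
  (IsProjective.iff_projective M).1 inferInstance

lemma eq_zero_of_stepClass_comp_eq_zero {S : List (List Gen)} {b : List Gen} (h : Compat b S)
    (hS : Kills K S (word K b)) {i j : ℕ} (y : Ext (cyc K S) X (i + 1))
    (hj : 1 + (i + 1) = j) (hy : (stepClass h hS).comp y hj = 0) : y = 0 :=
  haveI : Projective (stepComplex hS).X₂ := inferInstanceAs (Projective (ModuleCat.of (A K) (A K)))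
  eq_zero_of_extClass_comp_eq_zero (stepComplex_shortExact h hS) y hj hy

lemma unit_ne_zero : unit K ≠ 0 := by simp [unit]

lemma stepClass_comp_proj_ne_zero {S : List (List Gen)} {b : List Gen} (h : Compat b S)
    (hS : Kills K S (word K b)) (hS' : [] ∉ S) (hb : b ≠ []) :
    (stepClass h hS).comp (Ext.mk₀ (proj K S hS')) (add_zero 1) ≠ 0 := by
  intro h0
  obtain ⟨y, hy⟩ := Ext.contravariant_sequence_exact₁ (stepComplex_shortExact h hS) _ _ _ h0
  obtain ⟨f, rfl⟩ := (Ext.mk₀_bijective _ _).surjective y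
  rw [Ext.mk₀_comp_mk₀] at hy
  have h1 := congrArg (fun f => f.hom (Cyc.one K S)) ((Ext.mk₀_bijective _ _).injective hy)
  have h2 : f.hom (Cyc.desc hS (Cyc.one K S)) = unit K := h1.trans (proj_one _ _)
  rw [Cyc.desc_one, ← mul_one (word K b), ← smul_eq_mul, map_smul] at h2
  obtain rfl | ⟨L, i, rfl⟩ := b.eq_nil_or_concat'
  · exact hb rfl
  · exact unit_ne_zero (h2.symm.trans (by simp [word_append, smul_kMod]))

lemma exact_subtype_toSpanSingleton_unit : Function.Exact
    (LinearMap.ker (LinearMap.toSpanSingleton (A K) (KMod K) (unit K))).subtype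
    (LinearMap.toSpanSingleton (A K) (KMod K) (unit K)) :=
  LinearMap.exact_subtype_ker_map _

lemma toSpanSingleton_unit_surjective :
    Function.Surjective (LinearMap.toSpanSingleton (A K) (KMod K) (unit K)) := fun k => by
  refine ⟨algebraMap K (A K) ((kModEquiv K).symm k), ?_⟩
  rw [LinearMap.toSpanSingleton_apply, algebraMap_smul, unit, ← map_smul, smul_eq_mul, mul_one,
    LinearEquiv.apply_symm_apply]

section

variable {S : List (List Gen)} {l : Gen}

lemma exists_section (h : Compat [l] S) (hl : Kills K S (gen K l)) :
    ∃ (r : LinearMap.ker (LinearMap.toSpanSingleton (A K) (KMod K) (unit K)) →ₗ[A K] Cyc K S)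
      (s : Cyc K S →ₗ[A K] LinearMap.ker (LinearMap.toSpanSingleton (A K) (KMod K) (unit K))),
      r ∘ₗ s = .id ∧ OneExt.inl (h.extendable (Cyc.kills_one S)) ∘ₗ r =
        LinearMap.toSpanSingleton (A K) _ (OneExt.top (h.extendable (Cyc.kills_one S))) ∘ₗ
          Submodule.subtype _ := by
  set e := h.extendable (Cyc.kills_one (K := K) S)
  have key (a : LinearMap.ker (LinearMap.toSpanSingleton (A K) (KMod K) (unit K))) :
      ∃ y, OneExt.inl e y = (a : A K) • OneExt.top e := by
    refine (OneExt.exact e _).1 ?_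
    rw [map_smul, OneExt.snd_top]
    exact a.2
  choose f hf using key
  have hl' : gen K l ∈ LinearMap.ker (LinearMap.toSpanSingleton (A K) (KMod K) (unit K)) := by
    simp [smul_kMod]
  have hk : Kills K S (⟨gen K l, hl'⟩ : LinearMap.ker
      (LinearMap.toSpanSingleton (A K) (KMod K) (unit K))) := fun L hL => Subtype.ext (hl L hL)
  refine ⟨⟨⟨f, fun a b => OneExt.inl_injective e ?_⟩, fun a b => OneExt.inl_injective e ?_⟩,
    Cyc.desc hk, Cyc.hom_ext (OneExt.inl_injective e ?_), LinearMap.ext hf⟩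
  · simp [hf, add_smul]
  · simp [hf, mul_smul]
  · change OneExt.inl e (f (Cyc.desc hk (Cyc.one K S))) = OneExt.inl e (Cyc.one K S)
    rw [hf, Cyc.desc_one, OneExt.gen_smul_top, if_pos rfl]

lemma eq_zero_of_letterClass_comp_eq_zero (h : Compat [l] S) (hl : Kills K S (gen K l)) {i j : ℕ}
    (y : Ext (cyc K S) X (i + 1)) (hj : 1 + (i + 1) = j)
    (hy : (letterClass K h).comp y hj = 0) : y = 0 := by
  obtain ⟨r, s, hrs, hr⟩ := exists_section h hl
  let C : ShortComplex (ModuleCat.{0} (A K)) :=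
    exactComplex (X := ModuleCat.of (A K) (LinearMap.ker
      (LinearMap.toSpanSingleton (A K) (KMod K) (unit K)))) (Y := ModuleCat.of (A K) (A K))
      (Z := KMod K) (Submodule.subtype _) _ exact_subtype_toSpanSingleton_unit
  have hC : C.ShortExact := exactComplex_shortExact _ Subtype.val_injective
    toSpanSingleton_unit_surjective
  have : Projective C.X₂ := inferInstanceAs (Projective (ModuleCat.of (A K) (A K)))
  have h1 : hC.extClass.comp (Ext.mk₀ (ModuleCat.ofHom r)) (add_zero 1) =
      (Ext.mk₀ (𝟙 (KMod K))).comp (letterClass K h) (zero_add 1) := by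
    refine extClass_comp_mk₀ hC (letterComplex_shortExact K h) (ModuleCat.ofHom r)
      (ModuleCat.ofHom (LinearMap.toSpanSingleton (A K) _
        (OneExt.top (h.extendable (Cyc.kills_one (K := K) S))))) (𝟙 (KMod K)) hr.symm
        (LinearMap.ext_ring ?_)
    change (1 : A K) • unit K = OneExt.snd (h.extendable (Cyc.kills_one (K := K) S))
      ((1 : A K) • OneExt.top (h.extendable (Cyc.kills_one (K := K) S)))
    rw [one_smul, one_smul, OneExt.snd_top]
  rw [Ext.mk₀_id_comp] at h1
  rw [← h1, Ext.comp_assoc_of_second_deg_zero] at hy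
  have h2 := eq_zero_of_extClass_comp_eq_zero hC _ hj hy
  have h3 : (ModuleCat.ofHom s : cyc K S ⟶ C.X₁) ≫ (ModuleCat.ofHom r : C.X₁ ⟶ cyc K S) =
      𝟙 (cyc K S) :=
    ModuleCat.hom_ext (by exact hrs)
  rw [← Ext.mk₀_id_comp y, ← h3, ← Ext.mk₀_comp_mk₀, Ext.comp_assoc_of_second_deg_zero, h2,
    Ext.comp_zero]

end

/-- The class in `Ext¹(K, K)` obtained from `letterClass` by projecting to the trivial module. -/
noncomputable def letterProjClass {S : List (List Gen)} {l : Gen} (h : Compat [l] S)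
    (hS : [] ∉ S) : E K 1 :=
  (letterClass K h).comp (Ext.mk₀ (proj K S hS)) (add_zero 1)

/-- The class in `Ext¹(A / A b, K)` obtained from `stepClass` by projecting to the trivial
module. -/
noncomputable def stepProjClass {S : List (List Gen)} {b : List Gen} (h : Compat b S)
    (hb : Kills K S (word K b)) (hS : [] ∉ S) : Ext.{1} (cyc K [b]) (KMod K) 1 :=
  (stepClass h hb).comp (Ext.mk₀ (proj K S hS)) (add_zero 1)

/-- The class in `Ext²(K, K)` obtained by splicing `letterClass` and `stepClass`. -/
noncomputable def spliceClass {S : List (List Gen)} {b : List Gen} {l : Gen} (hl : Compat [l] [b])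
    (h : Compat b S) (hb : Kills K S (word K b)) (hS : [] ∉ S) : E K 2 :=
  (letterClass K hl).comp (stepProjClass h hb hS) one_add_one_eq_two

lemma kills_nil {M : Type} [AddCommGroup M] [Module (A K) M] (c : M) : Kills K [] c :=
  fun _ h => absurd h List.not_mem_nil

lemma mk₀_desc_comp_mk₀_proj {S S' : List (List Gen)} (hS : [] ∉ S) (hS' : [] ∉ S')
    (h : Kills K S (Cyc.one K S')) :
    (Ext.mk₀ (ModuleCat.ofHom (Cyc.desc h))).comp (Ext.mk₀ (proj K S' hS')) (add_zero 0) =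
      Ext.mk₀ (proj K S hS) := by
  rw [Ext.mk₀_comp_mk₀]
  congr 1
  refine ModuleCat.hom_ext (Cyc.hom_ext ?_)
  refine Eq.trans ?_ (proj_one S hS).symm
  change (proj K S' hS').hom (Cyc.desc h (Cyc.one K S)) = _
  rw [Cyc.desc_one, proj_one]

lemma mk₀_proj_comp_letterProjClass {l : Gen} (h : Compat [l] []) (hl : Kills K [] (word K [l])) :
    (Ext.mk₀ (proj K [[l]] (by simp))).comp (letterProjClass h List.not_mem_nil) (zero_add 1) =
      stepProjClass h hl List.not_mem_nil := by
  have hk : Kills K [] (word K [] • Cyc.one K []) := kills_nil _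
  have h1 := stepClass_comp_desc_eq_proj_comp_letterClass (b := []) h hl h hk
  rw [letterProjClass, ← Ext.comp_assoc_of_third_deg_zero]
  refine (congrArg (fun y => Ext.comp y _ _) h1.symm).trans ?_
  have hk' : Kills K [] (Cyc.one K []) := kills_nil _
  have h2 : Cyc.desc hk = Cyc.desc hk' := Cyc.hom_ext (by simp)
  rw [h2, Ext.comp_assoc_of_second_deg_zero, mk₀_desc_comp_mk₀_proj]
  rfl

lemma mk₀_proj_comp_spliceClass {S : List (List Gen)} {a b : List Gen} {l : Gen}
    (hl : Compat [l] [a ++ b]) (h : Compat (a ++ b) S) (hb : Kills K S (word K (a ++ b)))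
    (hS : [] ∉ S) (h' : Compat (b ++ [l]) [a]) (hb' : Kills K [a] (word K (b ++ [l])))
    (ha : Compat a []) :
    (Ext.mk₀ (proj K [b ++ [l]] (by simp))).comp (spliceClass hl h hb hS) (zero_add 2) =
      (stepClass h' hb').comp (stepProjClass ha (kills_nil _) List.not_mem_nil)
        one_add_one_eq_two := by
  have hk : Kills K [a] (word K b • Cyc.one K [a ++ b]) := by
    intro L hL
    obtain rfl := List.mem_singleton.1 hL
    rw [smul_smul, ← word_append]
    exact Cyc.kills_one _ _ (by simp)
  rw [spliceClass, ← Ext.comp_assoc _ _ _ (zero_add 1) one_add_one_eq_two (by simp),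
    ← stepClass_comp_desc_eq_proj_comp_letterClass h' hb' hl hk,
    Ext.comp_assoc_of_second_deg_zero, stepProjClass, ← Ext.comp_assoc_of_third_deg_zero,
    ← stepClass_comp_desc_eq_desc_comp_stepClass ha (kills_nil _) h hb (kills_nil _) hk,
    Ext.comp_assoc_of_third_deg_zero, mk₀_desc_comp_mk₀_proj, stepProjClass]

lemma stepProjClass_nil_comp {b : List Gen} (h : Compat b []) (hb : Kills K [] (word K b))
    {i j : ℕ} (y : Ext (KMod K) X (i + 1)) (hj : 1 + (i + 1) = j) :
    (stepProjClass h hb List.not_mem_nil).comp y hj = 0 := by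
  rw [stepProjClass, Ext.comp_assoc_of_second_deg_zero, Ext.eq_zero_of_projective (Ext.comp _ y _),
    Ext.comp_zero]

end Ext

end MonomialAlgebra

open MonomialAlgebra Abelian

/-- There exist `e₁, e₂ ∈ Extᴬ¹(K,K)` and
`α, β, γ ∈ Extᴬ²(K,K)` with the Yoneda products `e₁α ∈ Extᴬ³(K,K)`,
`βγ ∈ Extᴬ⁴(K,K)` and `γe₂ ∈ Extᴬ³(K,K)` all nonzero, while the Yoneda products
`(e₁α)β ∈ Extᴬ⁵(K,K)` and `(βγ)e₂ ∈ Extᴬ⁵(K,K)` are both zero. -/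
theorem statement_14 :
    ∃ (e₁ e₂ : E K 1) (α β γ : E K 2),
      e₁.comp α (by norm_num : 1 + 2 = 3) ≠ 0 ∧
      β.comp γ (by norm_num : 2 + 2 = 4) ≠ 0 ∧
      γ.comp e₂ (by norm_num : 2 + 1 = 3) ≠ 0 ∧
      (e₁.comp α (by norm_num : 1 + 2 = 3)).comp β (by norm_num : 3 + 2 = 5) = 0 ∧
      (β.comp γ (by norm_num : 2 + 2 = 4)).comp e₂ (by norm_num : 4 + 1 = 5) = 0 := by
  have kills {a b : List Gen} (h : ∃ L ∈ relations, L <:+: a ++ b) : Kills K [a] (word K b) := by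
    intro L hL
    obtain rfl := List.mem_singleton.1 hL
    rw [smul_eq_mul, ← word_append, word_eq_zero K h]
  have killsGen {a : List Gen} {l : Gen} (h : ∃ L ∈ relations, L <:+: a ++ [l]) :
      Kills K [a] (gen K l) := word_singleton K l ▸ kills h
  let e₁ : E K 1 := letterProjClass (S := [[n, p, q, r]]) (l := s) (by decide) (by decide)
  let e₂ : E K 1 := letterProjClass (S := []) (l := m) (by decide) (by decide)
  let α : E K 2 := spliceClass (S := [[m]]) (b := [n, n, p, q]) (l := r) (by decide) (by decide)
    (kills (by decide)) (by decide)
  let β : E K 2 := spliceClass (S := [[p, q, r]]) (b := [s, t]) (l := u) (by decide) (by decide)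
    (kills (by decide)) (by decide)
  have h₁ : e₁.comp α (by norm_num : 1 + 2 = 3) =
      (letterClass K (S := [[n, p, q, r]]) (l := s) (by decide)).comp
        ((stepClass (S := [[n]]) (b := [n, p, q, r]) (by decide) (kills (by decide))).comp
          (stepProjClass (S := []) (b := [n]) (by decide) (kills_nil _) (by decide))
          one_add_one_eq_two) (by norm_num : 1 + 2 = 3) := by
    refine (Ext.comp_assoc_of_second_deg_zero _ _ _ _).trans ?_
    exact congrArg (fun y => Ext.comp _ y _) (mk₀_proj_comp_spliceClass (S := [[m]]) (a := [n])
      (b := [n, p, q]) (l := r) (by decide) (by decide) (kills (by decide)) (by decide)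
      (by decide) (kills (by decide)) (by decide))
  have h₂ : β.comp α (by norm_num : 2 + 2 = 4) =
      (letterClass K (S := [[s, t]]) (l := u) (by decide)).comp
        ((stepClass (S := [[p, q, r]]) (b := [s, t]) (by decide) (kills (by decide))).comp
          ((stepClass (S := [[n, n]]) (b := [p, q, r]) (by decide) (kills (by decide))).comp
            (stepProjClass (S := []) (b := [n, n]) (by decide) (kills_nil _) (by decide))
            one_add_one_eq_two) (by norm_num : 1 + 2 = 3)) (by norm_num : 1 + 3 = 4) := by
    refine (Ext.comp_assoc _ _ _ one_add_one_eq_two (by norm_num : 1 + 2 = 3)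
      (by norm_num : 1 + 1 + 2 = 4)).trans ?_
    refine congrArg (fun y => Ext.comp _ y _)
      ((Ext.comp_assoc_of_second_deg_zero _ _ _ _).trans ?_)
    exact congrArg (fun y => Ext.comp _ y _) (mk₀_proj_comp_spliceClass (S := [[m]]) (a := [n, n])
      (b := [p, q]) (l := r) (by decide) (by decide) (kills (by decide)) (by decide)
      (by decide) (kills (by decide)) (by decide))
  have h₃ : α.comp e₂ (by norm_num : 2 + 1 = 3) =
      (letterClass K (S := [[n, n, p, q]]) (l := r) (by decide)).comp
        ((stepClass (S := [[m]]) (b := [n, n, p, q]) (by decide) (kills (by decide))).comp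
          (stepProjClass (S := []) (b := [m]) (by decide) (kills_nil _) (by decide))
          one_add_one_eq_two) (by norm_num : 1 + 2 = 3) := by
    refine (Ext.comp_assoc _ _ _ one_add_one_eq_two one_add_one_eq_two
      (by norm_num : 1 + 1 + 1 = 3)).trans ?_
    refine congrArg (fun y => Ext.comp _ y _)
      ((Ext.comp_assoc_of_second_deg_zero _ _ _ _).trans ?_)
    exact congrArg (fun y => Ext.comp _ y _) (mk₀_proj_comp_letterProjClass _ _)
  refine ⟨e₁, e₂, α, β, α, fun h => ?_, fun h => ?_, fun h => ?_, ?_, ?_⟩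
  · have := eq_zero_of_letterClass_comp_eq_zero _ (killsGen (by decide)) _ _ (h₁ ▸ h)
    exact stepClass_comp_proj_ne_zero _ _ _ (by decide)
      (eq_zero_of_stepClass_comp_eq_zero _ _ _ _ this)
  · have := eq_zero_of_letterClass_comp_eq_zero _ (killsGen (by decide)) _ _ (h₂ ▸ h)
    have := eq_zero_of_stepClass_comp_eq_zero _ _ _ _ this
    exact stepClass_comp_proj_ne_zero _ _ _ (by decide)
      (eq_zero_of_stepClass_comp_eq_zero _ _ _ _ this)
  · have := eq_zero_of_letterClass_comp_eq_zero _ (killsGen (by decide)) _ _ (h₃ ▸ h)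
    exact stepClass_comp_proj_ne_zero _ _ _ (by decide)
      (eq_zero_of_stepClass_comp_eq_zero _ _ _ _ this)
  · rw [h₁, Ext.comp_assoc _ _ _ _ (by norm_num : 2 + 2 = 4) _,
      Ext.comp_assoc _ _ _ _ (by norm_num : 1 + 2 = 3) _, stepProjClass_nil_comp, Ext.comp_zero,
      Ext.comp_zero]
    all_goals norm_num
  · rw [h₂, Ext.comp_assoc _ _ _ _ (by norm_num : 3 + 1 = 4) _,
      Ext.comp_assoc _ _ _ _ (by norm_num : 2 + 1 = 3) _,
      Ext.comp_assoc _ _ _ _ one_add_one_eq_two _, stepProjClass_nil_comp, Ext.comp_zero,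
      Ext.comp_zero, Ext.comp_zero]
    all_goals norm_num
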